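/- Define f : [0,2] × [0,1] → ℝ by f(a,b) = max(a − b, 0) + max(1 − a + b, 0). Then sup_{a ∈ [0,2]} inf_{b ∈ [0,1]} f(a,b) = 1 while inf_{b ∈ [0,1]} sup_{a ∈ [0,2]} f(a,b) = 3/2. In particular the max-min and min-max values differ, so f has no saddle point on [0,2] × [0,1]. -/

import Mathlib

/-- Sum-aggregated payoff of the two-sided continuous two-level Blotto counterexample:
Player 1 (maximizer) splits 2 soldiers as `(a, 2-a)`, Player 2 (minimizer) splits 1
soldier as `(b, 1-b)`, and each battlefield pays `max (σ¹ - σ², 0)`. -/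
noncomputable def f8 (a b : ℝ) : ℝ := max (a - b) 0 + max (1 - a + b) 0

theorem one_le_f8 (a b : ℝ) : 1 ≤ f8 a b := by
  unfold f8
  linarith [le_max_left (a - b) 0, le_max_left (1 - a + b) 0]

theorem exists_f8_eq_one {a : ℝ} (ha : a ∈ Set.Icc (0:ℝ) 2) :
    ∃ b ∈ Set.Icc (0:ℝ) 1, f8 a b = 1 := by
  obtain ⟨h0, h2⟩ := ha
  rcases le_total a 1 with h | h
  · exact ⟨a, ⟨h0, h⟩, by norm_num [f8]⟩
  · exact ⟨a - 1, ⟨by linarith, by linarith⟩, by norm_num [f8]⟩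

theorem iInf_f8 (a : Set.Icc (0:ℝ) 2) : ⨅ b : Set.Icc (0:ℝ) 1, f8 a b = 1 := by
  obtain ⟨b, hb, h⟩ := exists_f8_eq_one a.2
  refine IsLeast.csInf_eq ⟨⟨⟨b, hb⟩, h⟩, ?_⟩
  rintro _ ⟨b, rfl⟩
  exact one_le_f8 a b

theorem f8_zero {b : ℝ} (hb : b ∈ Set.Icc (0:ℝ) 1) : f8 0 b = 1 + b := by
  obtain ⟨h0, h1⟩ := hb
  rw [f8, max_eq_right (by linarith), max_eq_left (by linarith)]
  ring

theorem f8_two {b : ℝ} (hb : b ∈ Set.Icc (0:ℝ) 1) : f8 2 b = 2 - b := by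
  obtain ⟨h0, h1⟩ := hb
  rw [f8, max_eq_left (by linarith), max_eq_right (by linarith)]
  ring

theorem f8_le_max {a b : ℝ} (ha : a ∈ Set.Icc (0:ℝ) 2) (hb : b ∈ Set.Icc (0:ℝ) 1) :
    f8 a b ≤ max (1 + b) (2 - b) := by
  obtain ⟨ha0, ha2⟩ := ha
  obtain ⟨hb0, hb1⟩ := hb
  have := le_max_left (1 + b) (2 - b)
  have := le_max_right (1 + b) (2 - b)
  unfold f8
  rcases max_cases (a - b) 0 with h | h <;> rcases max_cases (1 - a + b) 0 with h' | h' <;>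
    linarith

theorem iSup_f8 (b : Set.Icc (0:ℝ) 1) :
    ⨆ a : Set.Icc (0:ℝ) 2, f8 a b = max (1 + (b : ℝ)) (2 - b) := by
  refine IsGreatest.csSup_eq ⟨?_, ?_⟩
  · rcases max_choice (1 + (b : ℝ)) (2 - b) with h | h
    · exact ⟨⟨0, by norm_num⟩, (f8_zero b.2).trans h.symm⟩
    · exact ⟨⟨2, by norm_num⟩, (f8_two b.2).trans h.symm⟩
  · rintro _ ⟨a, rfl⟩
    exact f8_le_max a.2 b.2

/-- the max-min value of `f8` on `[0,2] × [0,1]` is `1`, the min-max value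
is `3/2`; in particular they differ and `f8` has no saddle point. -/
theorem stmt_8 :
    (⨆ a : Set.Icc (0:ℝ) 2, ⨅ b : Set.Icc (0:ℝ) 1, f8 a b) = 1 ∧
    (⨅ b : Set.Icc (0:ℝ) 1, ⨆ a : Set.Icc (0:ℝ) 2, f8 a b) = 3/2 ∧
    ¬ ∃ as ∈ Set.Icc (0:ℝ) 2, ∃ bs ∈ Set.Icc (0:ℝ) 1,
        ∀ a ∈ Set.Icc (0:ℝ) 2, ∀ b ∈ Set.Icc (0:ℝ) 1,
          f8 a bs ≤ f8 as bs ∧ f8 as bs ≤ f8 as b := by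
  refine ⟨?_, ?_, ?_⟩
  · have : Nonempty (Set.Icc (0:ℝ) 2) := ⟨⟨0, by norm_num⟩⟩
    simp only [iInf_f8, ciSup_const]
  · simp only [iSup_f8]
    refine IsLeast.csInf_eq ⟨⟨⟨1 / 2, by norm_num⟩, by norm_num⟩, ?_⟩
    rintro _ ⟨b, rfl⟩
    have := le_max_left (1 + (b : ℝ)) (2 - b)
    have := le_max_right (1 + (b : ℝ)) (2 - b)
    dsimp only
    linarith
  · rintro ⟨a, ha, b, hb, h⟩
    obtain ⟨c, hc, hac⟩ := exists_f8_eq_one ha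
    have hzero := h 0 (by norm_num) c hc
    have htwo := h 2 (by norm_num) c hc
    rw [f8_zero hb] at hzero
    rw [f8_two hb] at htwo
    linarith [hzero.1, hzero.2, htwo.1]
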